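/- There is no voting method whose domain is the set of all profiles with at most 4 candidates that satisfies anonymity, neutrality, binary γ, and quasi-resoluteness. -/

import Mathlib

/- Formalization of voting-theoretic notions from Holliday, Norman, Pacuit, Zahedian,
"Impossibility theorems involving weakenings of expansion consistency and resoluteness
in voting". Candidates form an infinite type `C` and voters an infinite type `V`. -/

open Classical

noncomputable section

/-- `L` is a strict linear order on exactly the finite set `s`. -/
def IsStrictLinearOrderOn {C : Type} (s : Finset C) (L : C → C → Prop) : Prop :=
  (∀ x, ¬ L x x) ∧ (∀ x y z, L x y → L y z → L x z) ∧
    (∀ x ∈ s, ∀ y ∈ s, x ≠ y → L x y ∨ L y x) ∧ ∀ x y, L x y → x ∈ s ∧ y ∈ s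

/-- Restriction of a relation to a finite set `A`. -/
def restrictRel {C : Type} (A : Finset C) (L : C → C → Prop) : C → C → Prop :=
  fun x y => L x y ∧ x ∈ A ∧ y ∈ A

theorem IsStrictLinearOrderOn.restrict {C : Type} {s A : Finset C} {L : C → C → Prop}
    (h : IsStrictLinearOrderOn s L) (hA : A ⊆ s) :
    IsStrictLinearOrderOn A (restrictRel A L) := by
  obtain ⟨hirr, htr, htot, hdom⟩ := h
  refine ⟨fun x hx => hirr x hx.1,
    fun x y z hxy hyz => ⟨htr _ _ _ hxy.1 hyz.1, hxy.2.1, hyz.2.2⟩, ?_,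
    fun x y hxy => ⟨hxy.2.1, hxy.2.2⟩⟩
  intro x hx y hy hne
  rcases htot x (hA hx) y (hA hy) hne with h' | h'
  · exact Or.inl ⟨h', hx, hy⟩
  · exact Or.inr ⟨h', hy, hx⟩

/-- The image of a relation under the transposition of `a` and `b`. -/
def swapRel {C : Type} (a b : C) (L : C → C → Prop) : C → C → Prop :=
  fun x y => L (Equiv.swap a b x) (Equiv.swap a b y)

theorem IsStrictLinearOrderOn.swapRel_mem {C : Type} {s : Finset C} {L : C → C → Prop}
    (a b : C) (h : IsStrictLinearOrderOn s L) :
    IsStrictLinearOrderOn (s.image (Equiv.swap a b)) (swapRel a b L) := by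
  obtain ⟨hirr, htr, htot, hdom⟩ := h
  refine ⟨fun x => hirr _, fun x y z hxy hyz => htr _ _ _ hxy hyz, ?_, ?_⟩
  · intro x hx y hy hne
    obtain ⟨x', hx', rfl⟩ := Finset.mem_image.mp hx
    obtain ⟨y', hy', rfl⟩ := Finset.mem_image.mp hy
    have hne' : x' ≠ y' := by rintro rfl; exact hne rfl
    have := htot x' hx' y' hy' hne'
    simpa [swapRel, Equiv.swap_apply_self] using this
  · intro x y hxy
    obtain ⟨h1, h2⟩ := hdom _ _ hxy
    exact ⟨Finset.mem_image.mpr ⟨_, h1, Equiv.swap_apply_self a b x⟩,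
      Finset.mem_image.mpr ⟨_, h2, Equiv.swap_apply_self a b y⟩⟩

/-- A preference profile: each voter in the finite set `voters` submits a strict linear
order of the finite nonempty set `cands` of candidates. -/
structure Profile (C V : Type) where
  voters : Finset V
  cands : Finset C
  cands_nonempty : cands.Nonempty
  ballot : V → C → C → Prop
  ballot_lin : ∀ i ∈ voters, IsStrictLinearOrderOn cands (ballot i)

namespace Profile

variable {C V : Type}

/-- The margin of `x` over `y` in `P`: the number of voters ranking `x` above `y`
minus the number of voters ranking `y` above `x`. -/
def margin (P : Profile C V) (x y : C) : ℤ :=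
  ((P.voters.filter (fun i => P.ballot i x y)).card : ℤ) -
    ((P.voters.filter (fun i => P.ballot i y x)).card : ℤ)

/-- The profile `P^{i⇄j}` obtained by transposing the voters `i` and `j`. -/
def swapVoters (P : Profile C V) (i j : V) : Profile C V where
  voters := P.voters.image (Equiv.swap i j)
  cands := P.cands
  cands_nonempty := P.cands_nonempty
  ballot := fun k => P.ballot (Equiv.swap i j k)
  ballot_lin := by
    intro k hk
    obtain ⟨m, hm, rfl⟩ := Finset.mem_image.mp hk
    simpa [Equiv.swap_apply_self] using P.ballot_lin m hm

/-- The profile `P_{a⇄b}` obtained by transposing the candidates `a` and `b`. -/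
def swapCands (P : Profile C V) (a b : C) : Profile C V where
  voters := P.voters
  cands := P.cands.image (Equiv.swap a b)
  cands_nonempty := P.cands_nonempty.image _
  ballot := fun i => swapRel a b (P.ballot i)
  ballot_lin := fun i hi => (P.ballot_lin i hi).swapRel_mem a b

/-- The restriction `P|_A` of a profile to a nonempty subset `A` of its candidates. -/
def restrict (P : Profile C V) (A : Finset C) (hA : A.Nonempty) (hsub : A ⊆ P.cands) :
    Profile C V where
  voters := P.voters
  cands := A
  cands_nonempty := hA
  ballot := fun i => restrictRel A (P.ballot i)
  ballot_lin := fun i hi => (P.ballot_lin i hi).restrict hsub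

/-- The profile `P_{-y}`, i.e. `P` with the candidate `y` removed. -/
def minus (P : Profile C V) (y : C) (h : (P.cands.erase y).Nonempty) : Profile C V :=
  P.restrict (P.cands.erase y) h (P.cands.erase_subset y)

/-- The profile `P|_{{x,y}}`, i.e. `P` restricted to the two candidates `x` and `y`. -/
def pair (P : Profile C V) (x y : C) (hx : x ∈ P.cands) (hy : y ∈ P.cands) : Profile C V :=
  P.restrict {x, y} ⟨x, Finset.mem_insert_self x {y}⟩
    (by
      intro z hz
      rcases Finset.mem_insert.mp hz with rfl | hz
      · exact hx
      · rcases Finset.mem_singleton.mp hz with rfl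
        exact hy)

/-- `P` is uniquely weighted: no two distinct ordered pairs of distinct candidates
have the same margin. -/
def UniquelyWeighted (P : Profile C V) : Prop :=
  ∀ a ∈ P.cands, ∀ b ∈ P.cands, ∀ x ∈ P.cands, ∀ y ∈ P.cands,
    a ≠ b → x ≠ y → (a, b) ≠ (x, y) → P.margin a b ≠ P.margin x y

/-- `P` is uniquely ranked: in every subelection with at least two candidates, no two
candidates have the same number of `n`-th place votes, and no two candidates have the
same Borda score. -/
def UniquelyRanked (P : Profile C V) : Prop :=
  ∀ Y ⊆ P.cands, 2 ≤ Y.card →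
    ((∀ n : ℕ, 1 ≤ n → n ≤ Y.card → ∀ x ∈ Y, ∀ y ∈ Y, x ≠ y →
        (P.voters.filter
            (fun i => (Y.filter (fun z => P.ballot i z x)).card = n - 1)).card ≠
          (P.voters.filter
            (fun i => (Y.filter (fun z => P.ballot i z y)).card = n - 1)).card) ∧
      (∀ x ∈ Y, ∀ y ∈ Y, x ≠ y →
        (∑ i ∈ P.voters, (Y.filter (fun z => P.ballot i x z)).card) ≠
          ∑ i ∈ P.voters, (Y.filter (fun z => P.ballot i y z)).card))

/-- `Q` is an `n`-fold copy `nP` of `P`: same candidates, and there is a map sending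
the voters of `Q` onto the voters of `P` such that each voter of `P` has exactly `n`
preimages, each with the same ballot. -/
def IsCopy (Q P : Profile C V) (n : ℕ) : Prop :=
  Q.cands = P.cands ∧
    ∃ h : V → V,
      (∀ j ∈ Q.voters, h j ∈ P.voters) ∧
      (∀ i ∈ P.voters, (Q.voters.filter (fun j => h j = i)).card = n) ∧
      (∀ j ∈ Q.voters, Q.ballot j = P.ballot (h j))

/-- `Q` is obtained from `P` by deleting one voter with each linear order of the
candidates of `P`. -/
def IsCancelOf (Q P : Profile C V) : Prop :=
  Q.cands = P.cands ∧ Q.voters ⊆ P.voters ∧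
    (∀ j ∈ Q.voters, Q.ballot j = P.ballot j) ∧
    ∀ L : C → C → Prop, IsStrictLinearOrderOn P.cands L →
      ((P.voters \ Q.voters).filter (fun i => P.ballot i = L)).card = 1

end Profile

/-- A voting method: a function assigning to each profile in a nonempty domain a
nonempty set of winners among its candidates. -/
structure VotingMethod (C V : Type) where
  dom : Set (Profile C V)
  dom_nonempty : dom.Nonempty
  winners : Profile C V → Finset C
  winners_nonempty : ∀ P ∈ dom, (winners P).Nonempty
  winners_sub : ∀ P ∈ dom, winners P ⊆ P.cands

namespace VotingMethod

variable {C V : Type}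

/-- Anonymity: transposing two voters does not change the winners. -/
def Anonymous (F : VotingMethod C V) : Prop :=
  ∀ P ∈ F.dom, ∀ i j : V, P.swapVoters i j ∈ F.dom →
    F.winners (P.swapVoters i j) = F.winners P

/-- Neutrality: transposing two candidates transposes the winners accordingly. -/
def Neutral (F : VotingMethod C V) : Prop :=
  ∀ P ∈ F.dom, ∀ a b : C, P.swapCands a b ∈ F.dom →
    F.winners (P.swapCands a b) = (F.winners P).image (Equiv.swap a b)

/-- Binary resoluteness: a unique winner in any two-candidate profile. -/
def BinaryResolute (F : VotingMethod C V) : Prop :=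
  ∀ P ∈ F.dom, P.cands.card = 2 → (F.winners P).card = 1

/-- Binary quasi-resoluteness: a unique winner in any two-candidate profile whose
two distinct candidates have a nonzero margin between them. -/
def BinaryQuasiResolute (F : VotingMethod C V) : Prop :=
  ∀ P ∈ F.dom, P.cands.card = 2 →
    (∀ x ∈ P.cands, ∀ y ∈ P.cands, x ≠ y → P.margin x y ≠ 0) →
    (F.winners P).card = 1

/-- Quasi-resoluteness: a unique winner in any uniquely weighted profile. -/
def QuasiResolute (F : VotingMethod C V) : Prop :=
  ∀ P ∈ F.dom, P.UniquelyWeighted → (F.winners P).card = 1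

/-- Weak quasi-resoluteness: a unique winner in any profile that is both uniquely
weighted and uniquely ranked. -/
def WeakQuasiResolute (F : VotingMethod C V) : Prop :=
  ∀ P ∈ F.dom, P.UniquelyWeighted → P.UniquelyRanked → (F.winners P).card = 1

/-- Binary γ: if `x` wins without `y` and wins the head-to-head against `y`,
then `x` wins with `y` included. -/
def BinaryGamma (F : VotingMethod C V) : Prop :=
  ∀ P ∈ F.dom, ∀ x, ∀ hx : x ∈ P.cands, ∀ y, ∀ hy : y ∈ P.cands, x ≠ y →
    ∀ h : (P.cands.erase y).Nonempty,
      P.minus y h ∈ F.dom → P.pair x y hx hy ∈ F.dom →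
      x ∈ F.winners (P.minus y h) → F.winners (P.pair x y hx hy) = {x} →
      x ∈ F.winners P

/-- α-resoluteness: if `x` wins without `y` and wins the head-to-head against `y`,
then adding `y` does not enlarge the set of winners. -/
def AlphaResolute (F : VotingMethod C V) : Prop :=
  ∀ P ∈ F.dom, ∀ x, ∀ hx : x ∈ P.cands, ∀ y, ∀ hy : y ∈ P.cands, x ≠ y →
    ∀ h : (P.cands.erase y).Nonempty,
      P.minus y h ∈ F.dom → P.pair x y hx hy ∈ F.dom →
      x ∈ F.winners (P.minus y h) → F.winners (P.pair x y hx hy) = {x} →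
      (F.winners P).card ≤ (F.winners (P.minus y h)).card

/-- Homogeneity: replacing each voter by `n` copies of that voter does not change
the winners. -/
def Homogeneous (F : VotingMethod C V) : Prop :=
  ∀ P ∈ F.dom, ∀ Q ∈ F.dom, ∀ n : ℕ, 0 < n → Q.IsCopy P n → F.winners Q = F.winners P

/-- Cancellativity: deleting one voter with each linear order of the candidates does
not change the winners. -/
def Cancellative (F : VotingMethod C V) : Prop :=
  ∀ P ∈ F.dom, ∀ Q ∈ F.dom, Q.IsCancelOf P → F.winners Q = F.winners P

/-- Majoritarianism: the winners depend only on the majority graph of the profile. -/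
def Majoritarian (F : VotingMethod C V) : Prop :=
  ∀ P ∈ F.dom, ∀ P' ∈ F.dom, P.cands = P'.cands →
    (∀ x ∈ P.cands, ∀ y ∈ P.cands, (0 < P.margin x y ↔ 0 < P'.margin x y)) →
    F.winners P = F.winners P'

/-- Pairwiseness: the winners depend only on the margin graph of the profile. -/
def Pairwise (F : VotingMethod C V) : Prop :=
  ∀ P ∈ F.dom, ∀ P' ∈ F.dom, P.cands = P'.cands →
    (∀ x ∈ P.cands, ∀ y ∈ P.cands, P.margin x y = P'.margin x y) →
    F.winners P = F.winners P'

end VotingMethod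


/-- ballot relation on `C` coming from a list of indices -/
def nvRel {C : Type} (c : Fin 4 ↪ C) (l : List (Fin 4)) : C → C → Prop :=
  fun x y => ∃ p q, c p = x ∧ c q = y ∧ [p, q].Sublist l

def nvBal {C V : Type} (c : Fin 4 ↪ C) (e : ℕ ↪ V) (B : List (List (Fin 4))) (v : V) :
    C → C → Prop :=
  fun x y => ∃ n, e n = v ∧ ∃ l, B[n]? = some l ∧ nvRel c l x y

structure NvProf {C V : Type} (c : Fin 4 ↪ C) (e : ℕ ↪ V) (P : Profile C V)
    (X : Finset (Fin 4)) (B : List (List (Fin 4))) : Prop where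
  voters : P.voters = (Finset.range B.length).map e
  cands : P.cands = X.map c
  ballot : ∀ v, P.ballot v = nvBal c e B v

theorem nv_ext {C V : Type} {P Q : Profile C V} (h1 : P.voters = Q.voters)
    (h2 : P.cands = Q.cands) (h3 : P.ballot = Q.ballot) : P = Q := by
  cases P; cases Q; simp only at h1 h2 h3; subst h1 h2 h3; rfl

theorem nvBal_e {C V : Type} (c : Fin 4 ↪ C) (e : ℕ ↪ V) (B : List (List (Fin 4))) (n : ℕ)
    (h : n < B.length) : nvBal c e B (e n) = nvRel c B[n] := by
  funext x y
  apply propext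
  constructor
  · rintro ⟨m, hm, l, hl, hr⟩
    obtain rfl := e.injective hm
    rw [List.getElem?_eq_getElem h] at hl
    cases hl
    exact hr
  · intro hr
    exact ⟨n, rfl, _, List.getElem?_eq_getElem h, hr⟩

theorem nv_unique {C V : Type} {c : Fin 4 ↪ C} {e : ℕ ↪ V} {P Q : Profile C V}
    {X : Finset (Fin 4)} {B : List (List (Fin 4))}
    (h : NvProf c e P X B) (h' : NvProf c e Q X B) : P = Q :=
  nv_ext (h.voters.trans h'.voters.symm) (h.cands.trans h'.cands.symm)
    (funext fun v => (h.ballot v).trans (h'.ballot v).symm)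

theorem nv_lin {C V : Type} {c : Fin 4 ↪ C} {e : ℕ ↪ V} {P : Profile C V}
    {X : Finset (Fin 4)} {B : List (List (Fin 4))}
    (h : NvProf c e P X B) : ∀ l ∈ B, IsStrictLinearOrderOn (X.map c) (nvRel c l) := by
  intro l hl
  obtain ⟨n, hn, rfl⟩ := List.getElem_of_mem hl
  have := P.ballot_lin (e n) (by rw [h.voters]; simpa using hn)
  rwa [h.cands, h.ballot, nvBal_e c e B n hn] at this

theorem nv_exists {C V : Type} (c : Fin 4 ↪ C) (e : ℕ ↪ V)
    {X : Finset (Fin 4)} (hX : X.Nonempty) {B : List (List (Fin 4))}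
    (h : ∀ l ∈ B, IsStrictLinearOrderOn (X.map c) (nvRel c l)) :
    ∃ P : Profile C V, NvProf c e P X B := by
  refine ⟨⟨(Finset.range B.length).map e, X.map c, by simpa using hX, nvBal c e B, ?_⟩,
    rfl, rfl, fun _ => rfl⟩
  intro i hi
  simp only [Finset.mem_map, Finset.mem_range] at hi
  obtain ⟨n, hn, rfl⟩ := hi
  rw [nvBal_e c e B n hn]
  exact h _ (List.getElem_mem hn)

theorem nv_swapVoters {C V : Type} {c : Fin 4 ↪ C} {e : ℕ ↪ V} {P : Profile C V}
    {X : Finset (Fin 4)} {A R : List (List (Fin 4))} {x y : List (Fin 4)}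
    (h : NvProf c e P X (A ++ x :: y :: R)) :
    NvProf c e (P.swapVoters (e A.length) (e (A.length + 1))) X (A ++ y :: x :: R) := by
  have hidx : ∀ k : ℕ, (A ++ y :: x :: R)[k]? =
      (A ++ x :: y :: R)[Equiv.swap A.length (A.length + 1) k]? := by
    intro k
    rcases lt_trichotomy k A.length with hk | hk | hk
    · rw [Equiv.swap_apply_of_ne_of_ne (by omega) (by omega)]
      rw [List.getElem?_append_left hk, List.getElem?_append_left hk]
    · subst hk
      rw [Equiv.swap_apply_left]
      simp
    · rcases Nat.lt_or_ge (A.length + 1) k with hk2 | hk2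
      · rw [Equiv.swap_apply_of_ne_of_ne (by omega) (by omega)]
        obtain ⟨j, rfl⟩ : ∃ j, k = A.length + (j + 2) := ⟨k - A.length - 2, by omega⟩
        simp [List.getElem?_append_right]
      · obtain rfl : k = A.length + 1 := by omega
        rw [Equiv.swap_apply_right]
        simp
  have hsw : ∀ k, Equiv.swap (e A.length) (e (A.length + 1)) (e k) =
      e (Equiv.swap A.length (A.length + 1) k) := by
    intro k
    exact (e.injective.swap_apply _ _ _)
  refine ⟨?_, h.cands, ?_⟩
  · ext v
    simp only [Profile.swapVoters, h.voters, Finset.mem_image, Finset.mem_map, Finset.mem_range]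
    have hlt : ∀ k, k < (A ++ x :: y :: R).length →
        Equiv.swap A.length (A.length + 1) k < (A ++ y :: x :: R).length := by
      intro k hk
      simp only [List.length_append, List.length_cons] at hk ⊢
      rw [Equiv.swap_apply_def]
      split_ifs <;> omega
    constructor
    · rintro ⟨_, ⟨k, hk, rfl⟩, rfl⟩
      exact ⟨_, hlt k hk, (hsw k).symm⟩
    · rintro ⟨k, hk, rfl⟩
      have hk' : k < (A ++ x :: y :: R).length := by simpa using hk
      have := hlt k hk'
      refine ⟨_, ⟨Equiv.swap A.length (A.length + 1) k, by simpa using this, rfl⟩, ?_⟩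
      rw [hsw, Equiv.swap_apply_self]
  · intro v
    show P.ballot (Equiv.swap (e A.length) (e (A.length + 1)) v) = _
    rw [h.ballot]
    funext a b
    apply propext
    constructor
    · rintro ⟨n, hn, l, hl, hr⟩
      refine ⟨Equiv.swap A.length (A.length + 1) n, ?_, l, ?_, hr⟩
      · rw [← hsw, hn, Equiv.swap_apply_self]
      · rw [hidx, Equiv.swap_apply_self, hl]
    · rintro ⟨n, hn, l, hl, hr⟩
      refine ⟨Equiv.swap A.length (A.length + 1) n, ?_, l, ?_, hr⟩
      · rw [← hsw, hn]
      · rw [← hidx, hl]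

theorem nv_swapCands {C V : Type} {c : Fin 4 ↪ C} {e : ℕ ↪ V} {P : Profile C V}
    {X : Finset (Fin 4)} {B : List (List (Fin 4))} (h : NvProf c e P X B) (p q : Fin 4) :
    NvProf c e (P.swapCands (c p) (c q)) (X.map (Equiv.swap p q).toEmbedding)
      (B.map (List.map (Equiv.swap p q))) := by
  have hsw : ∀ k, Equiv.swap (c p) (c q) (c k) = c (Equiv.swap p q k) := fun k =>
    c.injective.swap_apply _ _ _
  refine ⟨?_, ?_, ?_⟩
  · simp [Profile.swapCands, h.voters]
  · ext x
    simp only [Profile.swapCands, h.cands, Finset.mem_image, Finset.mem_map,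
      Equiv.coe_toEmbedding]
    constructor
    · rintro ⟨_, ⟨k, hk, rfl⟩, rfl⟩
      exact ⟨_, ⟨k, hk, rfl⟩, (hsw k).symm⟩
    · rintro ⟨_, ⟨k, hk, rfl⟩, rfl⟩
      exact ⟨_, ⟨k, hk, rfl⟩, (hsw k)⟩
  · intro v
    funext x y
    apply propext
    show P.ballot v (Equiv.swap (c p) (c q) x) (Equiv.swap (c p) (c q) y) ↔ _
    rw [h.ballot]
    constructor
    · rintro ⟨n, hn, l, hl, a, b, ha, hb, hs⟩
      refine ⟨n, hn, l.map (Equiv.swap p q), by simp [hl], Equiv.swap p q a,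
        Equiv.swap p q b, ?_, ?_, ?_⟩
      · rw [← hsw, ha, Equiv.swap_apply_self]
      · rw [← hsw, hb, Equiv.swap_apply_self]
      · exact hs.map (Equiv.swap p q)
    · rintro ⟨n, hn, l, hl, a, b, rfl, rfl, hs⟩
      rw [List.getElem?_map] at hl
      obtain ⟨l', hl', rfl⟩ := Option.map_eq_some_iff.mp hl
      refine ⟨n, hn, l', hl', Equiv.swap p q a, Equiv.swap p q b, (hsw a).symm, (hsw b).symm, ?_⟩
      have := hs.map (Equiv.swap p q)
      simpa [List.map_map, Function.comp_def] using this

theorem nv_restrict {C V : Type} {c : Fin 4 ↪ C} {e : ℕ ↪ V} {P : Profile C V}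
    {X : Finset (Fin 4)} {B : List (List (Fin 4))} (h : NvProf c e P X B)
    (S : Finset C) (hS : S.Nonempty) (hsub : S ⊆ P.cands) (f : Fin 4 → Bool)
    (Y : Finset (Fin 4)) (hY : S = Y.map c) (hf : ∀ x ∈ X, f x = true ↔ x ∈ Y) :
    NvProf c e (P.restrict S hS hsub) Y (B.map (List.filter f)) := by
  have hdom := nv_lin h
  have hX : ∀ l ∈ B, ∀ p q, [p, q].Sublist l → p ∈ X ∧ q ∈ X := by
    intro l hl p q hs
    have := (hdom l hl).2.2.2 (c p) (c q) ⟨p, q, rfl, rfl, hs⟩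
    simpa using this
  refine ⟨?_, hY, ?_⟩
  · simp [Profile.restrict, h.voters]
  · intro v
    funext x y
    apply propext
    show (P.ballot v x y ∧ x ∈ S ∧ y ∈ S) ↔ _
    rw [h.ballot, hY]
    constructor
    · rintro ⟨⟨n, hn, l, hl, a, b, rfl, rfl, hs⟩, h1, h2⟩
      have hx := hX l (List.mem_of_getElem? hl) a b hs
      simp only [Finset.mem_map', ] at h1 h2
      refine ⟨n, hn, l.filter f, by simp [hl], a, b, rfl, rfl, ?_⟩
      have := hs.filter f
      rwa [List.filter_eq_self.mpr] at this
      intro z hz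
      simp only [List.mem_cons, List.not_mem_nil, or_false] at hz
      rcases hz with rfl | rfl
      · exact (hf _ hx.1).2 h1
      · exact (hf _ hx.2).2 h2
    · rintro ⟨n, hn, l, hl, a, b, rfl, rfl, hs⟩
      rw [List.getElem?_map] at hl
      obtain ⟨l', hl', rfl⟩ := Option.map_eq_some_iff.mp hl
      have hs' := hs.trans List.filter_sublist
      have hx := hX l' (List.mem_of_getElem? hl') a b hs'
      refine ⟨⟨n, hn, l', hl', a, b, rfl, rfl, hs'⟩, ?_, ?_⟩
      · have := hs.subset (a := a) (by simp)
        rw [List.mem_filter] at this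
        simpa using (hf _ hx.1).1 this.2
      · have := hs.subset (a := b) (by simp)
        rw [List.mem_filter] at this
        simpa using (hf _ hx.2).1 this.2

theorem nv_card (B : List (List (Fin 4))) (p : List (Fin 4) → Bool) :
    ((Finset.range B.length).filter (fun n => ∃ l, B[n]? = some l ∧ p l = true)).card =
      B.countP p := by
  induction B using List.reverseRecOn with
  | nil => simp
  | append_singleton B l ih =>
    rw [List.length_append, List.length_singleton, Finset.range_add_one, Finset.filter_insert,
      List.countP_append, ← ih]
    have h1 : (Finset.range B.length).filter
        (fun n => ∃ l', (B ++ [l])[n]? = some l' ∧ p l' = true) =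
        (Finset.range B.length).filter (fun n => ∃ l, B[n]? = some l ∧ p l = true) := by
      ext n
      simp only [Finset.mem_filter, and_congr_right_iff]
      intro hn
      rw [List.getElem?_append_left (Finset.mem_range.mp hn)]
    rw [h1]
    by_cases hp : p l = true
    · rw [if_pos (by simpa using hp), Finset.card_insert_of_notMem (by simp)]
      simp [hp]
    · rw [if_neg (by simpa using hp)]
      simp [hp]

theorem nv_margin {C V : Type} {c : Fin 4 ↪ C} {e : ℕ ↪ V} {P : Profile C V}
    {X : Finset (Fin 4)} {B : List (List (Fin 4))} (h : NvProf c e P X B) (p q : Fin 4) :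
    P.margin (c p) (c q) =
      (B.countP (fun l => [p, q].isSublist l) : ℤ) - (B.countP (fun l => [q, p].isSublist l) : ℤ) := by
  have key : ∀ p q : Fin 4, (P.voters.filter (fun i => P.ballot i (c p) (c q))).card =
      B.countP (fun l => [p, q].isSublist l) := by
    intro p q
    rw [← nv_card, h.voters, Finset.filter_map, Finset.card_map]
    congr 1
    ext n
    simp only [Finset.mem_filter, and_congr_right_iff]
    intro hn
    simp only [Function.comp, h.ballot]
    constructor
    · rintro ⟨m, hm, l, hl, a, b, ha, hb, hs⟩
      obtain rfl := e.injective hm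
      obtain rfl := c.injective ha
      obtain rfl := c.injective hb
      exact ⟨l, hl, by simpa using hs⟩
    · rintro ⟨l, hl, hs⟩
      exact ⟨n, rfl, l, hl, p, q, rfl, rfl, by simpa using hs⟩
  unfold Profile.margin
  rw [← key p q, ← key q p]

theorem nv_anon {C V : Type} {c : Fin 4 ↪ C} {e : ℕ ↪ V} {F : VotingMethod C V}
    (hd : F.dom = {P : Profile C V | P.cands.card ≤ 4}) (ha : F.Anonymous)
    {X : Finset (Fin 4)} {B B' : List (List (Fin 4))} (hB : B.Perm B') :
    ∀ (A : List (List (Fin 4))) (P P' : Profile C V), NvProf c e P X (A ++ B) →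
      NvProf c e P' X (A ++ B') → F.winners P = F.winners P' := by
  induction hB with
  | nil => intro A P P' h h'; rw [nv_unique h h']
  | cons x _ ih =>
    intro A P P' h h'
    refine ih (A ++ [x]) P P' ?_ ?_ <;> simpa
  | swap x y R =>
    intro A P P' h h'
    have h2 := nv_swapVoters h
    rw [nv_unique h' h2]
    have hc : P.cands.card ≤ 4 := by
      rw [h.cands, Finset.card_map]; exact X.card_le_univ
    exact (ha P (by rw [hd]; exact hc) _ _ (by rw [hd]; exact hc)).symm
  | @trans l1 l2 l3 h12 h23 ih1 ih2 =>
    intro A P P' h h'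
    have hX : X.Nonempty := by
      have := P.cands_nonempty
      rw [h.cands] at this
      simpa using this
    obtain ⟨Q, hQ⟩ := nv_exists (V := V) c e hX (B := A ++ l2) (by
      intro l hl
      refine nv_lin h l ?_
      exact ((h12.append_left A).mem_iff).2 hl)
    exact (ih1 A P Q h hQ).trans (ih2 A Q P' hQ h')

/-- `p` wins in the profile with candidates `X` and ballots `M`. -/
def NvW {C V : Type} (c : Fin 4 ↪ C) (e : ℕ ↪ V) (F : VotingMethod C V)
    (X : Finset (Fin 4)) (M : Multiset (List (Fin 4))) (p : Fin 4) : Prop :=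
  ∃ (P : Profile C V) (B : List (List (Fin 4))), (B : Multiset _) = M ∧ NvProf c e P X B ∧
    c p ∈ F.winners P

theorem nvW_iff {C V : Type} {c : Fin 4 ↪ C} {e : ℕ ↪ V} {F : VotingMethod C V}
    (hd : F.dom = {P : Profile C V | P.cands.card ≤ 4}) (ha : F.Anonymous)
    {X : Finset (Fin 4)} {B : List (List (Fin 4))} {P : Profile C V} (h : NvProf c e P X B)
    (p : Fin 4) : NvW c e F X (B : Multiset _) p ↔ c p ∈ F.winners P := by
  constructor
  · rintro ⟨Q, B', hB, hQ, hp⟩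
    rwa [nv_anon hd ha (Multiset.coe_eq_coe.mp hB) [] Q P hQ h] at hp
  · intro hp
    exact ⟨P, B, rfl, h, hp⟩

/-- valid ballots -/
def NvOk (X : Finset (Fin 4)) (l : List (Fin 4)) : Prop :=
  (∀ p, ¬ [p, p].Sublist l) ∧
  (∀ p q r, [p, q].Sublist l → [q, r].Sublist l → [p, r].Sublist l) ∧
  (∀ p ∈ X, ∀ q ∈ X, p ≠ q → [p, q].Sublist l ∨ [q, p].Sublist l) ∧
  ∀ p q, [p, q].Sublist l → p ∈ X ∧ q ∈ X

instance (X : Finset (Fin 4)) (l : List (Fin 4)) : Decidable (NvOk X l) := by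
  unfold NvOk; exact inferInstance

theorem NvOk.lin {C : Type} (c : Fin 4 ↪ C) {X : Finset (Fin 4)} {l : List (Fin 4)}
    (h : NvOk X l) : IsStrictLinearOrderOn (X.map c) (nvRel c l) := by
  obtain ⟨h1, h2, h3, h4⟩ := h
  refine ⟨?_, ?_, ?_, ?_⟩
  · rintro x ⟨p, q, rfl, hq, hs⟩
    obtain rfl := c.injective hq
    exact h1 _ hs
  · rintro x y z ⟨p, q, rfl, rfl, hs⟩ ⟨q', r, hq, rfl, hs'⟩
    obtain rfl := c.injective hq
    exact ⟨_, _, rfl, rfl, h2 _ _ _ hs hs'⟩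
  · intro x hx y hy hne
    simp only [Finset.mem_map] at hx hy
    obtain ⟨p, hp, rfl⟩ := hx
    obtain ⟨q, hq, rfl⟩ := hy
    rcases h3 p hp q hq (fun h => hne (by rw [h])) with h | h
    · exact Or.inl ⟨_, _, rfl, rfl, h⟩
    · exact Or.inr ⟨_, _, rfl, rfl, h⟩
  · rintro x y ⟨p, q, rfl, rfl, hs⟩
    have := h4 p q hs
    simpa using this

section
variable {C V : Type} {c : Fin 4 ↪ C} {e : ℕ ↪ V} {F : VotingMethod C V}

theorem nv_mem_dom (hd : F.dom = {P : Profile C V | P.cands.card ≤ 4}) {P : Profile C V}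
    {X : Finset (Fin 4)} {B : List (List (Fin 4))} (h : NvProf c e P X B) : P ∈ F.dom := by
  rw [hd]
  show P.cands.card ≤ 4
  rw [h.cands, Finset.card_map]
  exact X.card_le_univ

theorem nvW_get (hd : F.dom = {P : Profile C V | P.cands.card ≤ 4}) (ha : F.Anonymous)
    {X : Finset (Fin 4)} (hX : X.Nonempty) {M : Multiset (List (Fin 4))}
    (hM : ∀ l ∈ M, NvOk X l) :
    ∃ (P : Profile C V) (B : List (List (Fin 4))), (B : Multiset _) = M ∧ NvProf c e P X B ∧
      ∀ p, NvW c e F X M p ↔ c p ∈ F.winners P := by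
  induction M using Quot.inductionOn with
  | _ B =>
  obtain ⟨P, hP⟩ := nv_exists (V := V) c e hX (B := B) (fun l hl => (hM l hl).lin c)
  exact ⟨P, B, rfl, hP, nvW_iff hd ha hP⟩

theorem nvW_ex (hd : F.dom = {P : Profile C V | P.cands.card ≤ 4}) (ha : F.Anonymous)
    {X : Finset (Fin 4)} (hX : X.Nonempty) {M : Multiset (List (Fin 4))}
    (hM : ∀ l ∈ M, NvOk X l) : ∃ p ∈ X, NvW c e F X M p := by
  obtain ⟨P, B, rfl, hP, hW⟩ := nvW_get (c := c) (e := e) hd ha hX hM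
  obtain ⟨x, hx⟩ := F.winners_nonempty P (nv_mem_dom hd hP)
  have h2 := F.winners_sub P (nv_mem_dom hd hP) hx
  rw [hP.cands, Finset.mem_map] at h2
  obtain ⟨p, hp, rfl⟩ := h2
  exact ⟨p, hp, (hW p).2 hx⟩

theorem nvW_swap (hd : F.dom = {P : Profile C V | P.cands.card ≤ 4})
    (hn : F.Neutral) {X : Finset (Fin 4)} {M : Multiset (List (Fin 4))} {r : Fin 4}
    (p q : Fin 4) (h : NvW c e F X M r) :
    NvW c e F (X.map (Equiv.swap p q).toEmbedding) (M.map (List.map (Equiv.swap p q)))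
      (Equiv.swap p q r) := by
  obtain ⟨P, B, rfl, hP, hr⟩ := h
  have h2 := nv_swapCands hP p q
  refine ⟨_, _, rfl, h2, ?_⟩
  rw [hn P (nv_mem_dom hd hP) _ _ (nv_mem_dom hd h2)]
  rw [← c.injective.swap_apply]
  exact Finset.mem_image_of_mem _ hr

theorem nvW_uniq (hd : F.dom = {P : Profile C V | P.cands.card ≤ 4}) (ha : F.Anonymous)
    (hq : F.QuasiResolute)
    {X : Finset (Fin 4)} (hX : X.Nonempty) {M : Multiset (List (Fin 4))}
    (hM : ∀ l ∈ M, NvOk X l) (m : Fin 4 → Fin 4 → ℤ)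
    (hm : ∀ p ∈ X, ∀ q ∈ X, p ≠ q → (M.countP (fun l => [p, q].isSublist l) : ℤ) -
      (M.countP (fun l => [q, p].isSublist l) : ℤ) = m p q)
    (huw : ∀ p ∈ X, ∀ q ∈ X, ∀ r ∈ X, ∀ s ∈ X, p ≠ q → r ≠ s → (p, q) ≠ (r, s) →
      m p q ≠ m r s) {p q : Fin 4} (h1 : NvW c e F X M p) (h2 : NvW c e F X M q) : p = q := by
  obtain ⟨P, B, rfl, hP, hW⟩ := nvW_get (c := c) (e := e) hd ha hX hM
  have hmm : ∀ p ∈ X, ∀ q ∈ X, p ≠ q → P.margin (c p) (c q) = m p q := by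
    intro p hp q hq hne
    rw [nv_margin hP, ← hm p hp q hq hne]
    simp only [Multiset.coe_countP, Bool.decide_eq_true]
  have hc : (F.winners P).card = 1 := by
    apply hq P (nv_mem_dom hd hP)
    intro a ha b hb x hx y hy
    rw [hP.cands, Finset.mem_map] at ha hb hx hy
    obtain ⟨a, ha, rfl⟩ := ha
    obtain ⟨b, hb, rfl⟩ := hb
    obtain ⟨x, hx, rfl⟩ := hx
    obtain ⟨y, hy, rfl⟩ := hy
    intro h1 h2 h3
    have h1' : a ≠ b := fun h => h1 (by rw [h])
    have h2' : x ≠ y := fun h => h2 (by rw [h])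
    rw [hmm a ha b hb h1', hmm x hx y hy h2']
    refine huw a ha b hb x hx y hy h1' h2' (fun h => h3 ?_)
    simp only [Prod.mk.injEq] at h
    rw [h.1, h.2]
  obtain ⟨w, hw⟩ := Finset.card_eq_one.mp hc
  have e1 := (hW p).1 h1
  have e2 := (hW q).1 h2
  rw [hw, Finset.mem_singleton] at e1 e2
  exact c.injective (e1.trans e2.symm)

theorem nvW_gamma (hd : F.dom = {P : Profile C V | P.cands.card ≤ 4}) (ha : F.Anonymous)
    (hg : F.BinaryGamma)
    {X : Finset (Fin 4)} {M : Multiset (List (Fin 4))}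
    (hM : ∀ l ∈ M, NvOk X l) {x y : Fin 4} (hx : x ∈ X) (hy : y ∈ X) (hxy : x ≠ y)
    {f g : Fin 4 → Bool} (hf : ∀ z, f z = true ↔ z ≠ y) (hgg : ∀ z, g z = true ↔ z = x ∨ z = y)
    (h1 : NvW c e F (X.erase y) (M.map (List.filter f)) x)
    (h2 : ∀ z, z = x ∨ z = y → (NvW c e F {x, y} (M.map (List.filter g)) z ↔ z = x)) :
    NvW c e F X M x := by
  obtain ⟨P, B, rfl, hP, hW⟩ := nvW_get (c := c) (e := e) hd ha ⟨x, hx⟩ hM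
  have hxP : c x ∈ P.cands := by rw [hP.cands]; simpa using hx
  have hyP : c y ∈ P.cands := by rw [hP.cands]; simpa using hy
  have hne : (P.cands.erase (c y)).Nonempty :=
    ⟨c x, Finset.mem_erase.mpr ⟨fun h => hxy (c.injective h), hxP⟩⟩
  have hA : NvProf c e (P.minus (c y) hne) (X.erase y) (B.map (List.filter f)) := by
    apply nv_restrict hP
    · rw [hP.cands, Finset.map_erase]
    · intro z hz
      rw [hf, Finset.mem_erase]
      tauto
  have hB : NvProf c e (P.pair (c x) (c y) hxP hyP) {x, y} (B.map (List.filter g)) := by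
    apply nv_restrict hP
    · simp
    · intro z hz
      rw [hgg]; simp
  rw [hW]
  refine hg P (nv_mem_dom hd hP) (c x) hxP (c y) hyP (fun h => hxy (c.injective h)) hne
    (nv_mem_dom hd hA) (nv_mem_dom hd hB) ?_ ?_
  · rw [← nvW_iff hd ha hA]
    exact h1
  · have key : ∀ z, z = x ∨ z = y → (c z ∈ F.winners (P.pair (c x) (c y) hxP hyP) ↔ z = x) := by
      intro z hz
      rw [← nvW_iff hd ha hB, ← h2 z hz]
      rfl
    ext w
    rw [Finset.mem_singleton]
    constructor
    · intro hw
      have := F.winners_sub _ (nv_mem_dom hd hB) hw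
      rw [hB.cands, Finset.mem_map] at this
      obtain ⟨z, hz, rfl⟩ := this
      have hz' : z = x ∨ z = y := by simpa using hz
      rw [(key z hz').1 hw]
    · rintro rfl
      exact (key x (Or.inl rfl)).2 rfl

end

def nvP4 : List (List (Fin 4)) :=
  [[0,1,2,3],[0,1,3,2],[0,2,1,3],[0,2,3,1],[0,3,1,2],[0,3,2,1],
   [1,0,2,3],[1,0,3,2],[1,2,0,3],[1,2,3,0],[1,3,0,2],[1,3,2,0],
   [2,0,1,3],[2,0,3,1],[2,1,0,3],[2,1,3,0],[2,3,0,1],[2,3,1,0],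
   [3,0,1,2],[3,0,2,1],[3,1,0,2],[3,1,2,0],[3,2,0,1],[3,2,1,0]]

def nvMult (m : Fin 4 → Fin 4 → ℤ) : List (Fin 4) → ℕ
  | [p, q, r, s] => (20 + m p q + m q r + m r s).toNat
  | _ => 0

def nvM4 (m : Fin 4 → Fin 4 → ℤ) : Multiset (List (Fin 4)) :=
  (nvP4.map (fun l => nvMult m l • ({l} : Multiset (List (Fin 4))))).sum

def nvM3 (p q r : Fin 4) (x y z : ℤ) : Multiset (List (Fin 4)) :=
  (80 + 3 * (x + y)).toNat • {[p, q, r]} + (80 + 3 * (y + z)).toNat • {[q, r, p]} +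
  (80 + 3 * (z + x)).toNat • {[r, p, q]} + (80 - 3 * (x + y)).toNat • {[r, q, p]} +
  (80 - 3 * (y + z)).toNat • {[p, r, q]} + (80 - 3 * (z + x)).toNat • {[q, p, r]}

def nvM2 (p q : Fin 4) (w : ℤ) : Multiset (List (Fin 4)) :=
  (240 + 6 * w).toNat • {[p, q]} + (240 - 6 * w).toNat • {[q, p]}

theorem nvMult_cast {m : Fin 4 → Fin 4 → ℤ} (hb : ∀ p q, -6 ≤ m p q ∧ m p q ≤ 6)
    (p q r s : Fin 4) : (nvMult m [p, q, r, s] : ℤ) = 20 + m p q + m q r + m r s := by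
  have h1 := hb p q
  have h2 := hb q r
  have h3 := hb r s
  simp only [nvMult]
  omega

theorem nvM4_minus1 {m : Fin 4 → Fin 4 → ℤ} (hb : ∀ p q, -6 ≤ m p q ∧ m p q ≤ 6)
    (hs : ∀ p q, m p q = - m q p) (f : Fin 4 → Bool) (hf : f = fun z => decide (z ≠ 1)) :
    (nvM4 m).map (List.filter f) = nvM3 3 0 2 (m 3 0) (m 0 2) (m 2 3) := by
  subst hf
  have hm := nvMult_cast hb
  have b1 := hb 3 0
  have b2 := hb 0 2
  have b3 := hb 2 3
  have s01 := hs 0 1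
  have s02 := hs 0 2
  have s03 := hs 0 3
  have s12 := hs 1 2
  have s13 := hs 1 3
  have s23 := hs 2 3
  have e1 : (80 + 3 * (m 3 0 + m 0 2)).toNat = nvMult m [1,3,0,2] + nvMult m [3,1,0,2] +
    nvMult m [3,0,1,2] + nvMult m [3,0,2,1] := by zify; simp only [hm]; omega
  have e2 : (80 + 3 * (m 0 2 + m 2 3)).toNat = nvMult m [1,0,2,3] + nvMult m [0,1,2,3] +
    nvMult m [0,2,1,3] + nvMult m [0,2,3,1] := by zify; simp only [hm]; omega
  have e3 : (80 + 3 * (m 2 3 + m 3 0)).toNat = nvMult m [1,2,3,0] + nvMult m [2,1,3,0] +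
    nvMult m [2,3,1,0] + nvMult m [2,3,0,1] := by zify; simp only [hm]; omega
  have e4 : (80 - 3 * (m 3 0 + m 0 2)).toNat = nvMult m [1,2,0,3] + nvMult m [2,1,0,3] +
    nvMult m [2,0,1,3] + nvMult m [2,0,3,1] := by zify; simp only [hm]; omega
  have e5 : (80 - 3 * (m 0 2 + m 2 3)).toNat = nvMult m [1,3,2,0] + nvMult m [3,1,2,0] +
    nvMult m [3,2,1,0] + nvMult m [3,2,0,1] := by zify; simp only [hm]; omega
  have e6 : (80 - 3 * (m 2 3 + m 3 0)).toNat = nvMult m [1,0,3,2] + nvMult m [0,1,3,2] +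
    nvMult m [0,3,1,2] + nvMult m [0,3,2,1] := by zify; simp only [hm]; omega
  unfold nvM3
  rw [e1, e2, e3, e4, e5, e6]
  simp only [nvM4, nvP4, List.map_cons, List.map_nil, List.sum_cons, List.sum_nil,
    Multiset.map_add, Multiset.map_nsmul, Multiset.map_singleton, Multiset.map_zero, add_nsmul]
  simp only [List.filter, Fin.reduceEq, ne_eq, not_false_eq_true, not_true_eq_false, decide_true,
    decide_false]
  abel

theorem nvM4_minus2 {m : Fin 4 → Fin 4 → ℤ} (hb : ∀ p q, -6 ≤ m p q ∧ m p q ≤ 6)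
    (hs : ∀ p q, m p q = - m q p) (f : Fin 4 → Bool) (hf : f = fun z => decide (z ≠ 2)) :
    (nvM4 m).map (List.filter f) = nvM3 3 0 1 (m 3 0) (m 0 1) (m 1 3) := by
  subst hf
  have hm := nvMult_cast hb
  have b1 := hb 3 0
  have b2 := hb 0 1
  have b3 := hb 1 3
  have s01 := hs 0 1
  have s02 := hs 0 2
  have s03 := hs 0 3
  have s12 := hs 1 2
  have s13 := hs 1 3
  have s23 := hs 2 3
  have e1 : (80 + 3 * (m 3 0 + m 0 1)).toNat = nvMult m [2,3,0,1] + nvMult m [3,2,0,1] +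
    nvMult m [3,0,2,1] + nvMult m [3,0,1,2] := by zify; simp only [hm]; omega
  have e2 : (80 + 3 * (m 0 1 + m 1 3)).toNat = nvMult m [2,0,1,3] + nvMult m [0,2,1,3] +
    nvMult m [0,1,2,3] + nvMult m [0,1,3,2] := by zify; simp only [hm]; omega
  have e3 : (80 + 3 * (m 1 3 + m 3 0)).toNat = nvMult m [2,1,3,0] + nvMult m [1,2,3,0] +
    nvMult m [1,3,2,0] + nvMult m [1,3,0,2] := by zify; simp only [hm]; omega
  have e4 : (80 - 3 * (m 3 0 + m 0 1)).toNat = nvMult m [2,1,0,3] + nvMult m [1,2,0,3] +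
    nvMult m [1,0,2,3] + nvMult m [1,0,3,2] := by zify; simp only [hm]; omega
  have e5 : (80 - 3 * (m 0 1 + m 1 3)).toNat = nvMult m [2,3,1,0] + nvMult m [3,2,1,0] +
    nvMult m [3,1,2,0] + nvMult m [3,1,0,2] := by zify; simp only [hm]; omega
  have e6 : (80 - 3 * (m 1 3 + m 3 0)).toNat = nvMult m [2,0,3,1] + nvMult m [0,2,3,1] +
    nvMult m [0,3,2,1] + nvMult m [0,3,1,2] := by zify; simp only [hm]; omega
  unfold nvM3
  rw [e1, e2, e3, e4, e5, e6]
  simp only [nvM4, nvP4, List.map_cons, List.map_nil, List.sum_cons, List.sum_nil,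
    Multiset.map_add, Multiset.map_nsmul, Multiset.map_singleton, Multiset.map_zero, add_nsmul]
  simp only [List.filter, Fin.reduceEq, ne_eq, not_false_eq_true, not_true_eq_false, decide_true,
    decide_false]
  abel

theorem nvM4_pair01 {m : Fin 4 → Fin 4 → ℤ} (hb : ∀ p q, -6 ≤ m p q ∧ m p q ≤ 6)
    (hs : ∀ p q, m p q = - m q p) (f : Fin 4 → Bool) (hf : f = fun z => decide (z = 0 ∨ z = 1)) :
    (nvM4 m).map (List.filter f) = nvM2 0 1 (m 0 1) := by
  subst hf
  have hm := nvMult_cast hb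
  have b2 := hb 0 1
  have s01 := hs 0 1
  have s02 := hs 0 2
  have s03 := hs 0 3
  have s12 := hs 1 2
  have s13 := hs 1 3
  have s23 := hs 2 3
  have e1 : (240 + 6 * m 0 1).toNat =
    nvMult m [0,1,2,3] + nvMult m [0,1,3,2] + nvMult m [0,2,1,3] + nvMult m [0,2,3,1] +
    nvMult m [0,3,1,2] + nvMult m [0,3,2,1] + nvMult m [2,0,1,3] + nvMult m [2,0,3,1] +
    nvMult m [2,3,0,1] + nvMult m [3,0,1,2] + nvMult m [3,0,2,1] + nvMult m [3,2,0,1] := by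
    zify; simp only [hm]; omega
  have e2 : (240 - 6 * m 0 1).toNat =
    nvMult m [1,0,2,3] + nvMult m [1,0,3,2] + nvMult m [1,2,0,3] + nvMult m [1,2,3,0] +
    nvMult m [1,3,0,2] + nvMult m [1,3,2,0] + nvMult m [2,1,0,3] + nvMult m [2,1,3,0] +
    nvMult m [2,3,1,0] + nvMult m [3,1,0,2] + nvMult m [3,1,2,0] + nvMult m [3,2,1,0] := by
    zify; simp only [hm]; omega
  unfold nvM2
  rw [e1, e2]
  simp only [nvM4, nvP4, List.map_cons, List.map_nil, List.sum_cons, List.sum_nil,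
    Multiset.map_add, Multiset.map_nsmul, Multiset.map_singleton, Multiset.map_zero, add_nsmul]
  simp only [List.filter, Fin.reduceEq, or_false, or_true, or_self, decide_true,
    decide_false]
  abel

theorem nvM4_pair12 {m : Fin 4 → Fin 4 → ℤ} (hb : ∀ p q, -6 ≤ m p q ∧ m p q ≤ 6)
    (hs : ∀ p q, m p q = - m q p) (f : Fin 4 → Bool) (hf : f = fun z => decide (z = 1 ∨ z = 2)) :
    (nvM4 m).map (List.filter f) = nvM2 1 2 (m 1 2) := by
  subst hf
  have hm := nvMult_cast hb
  have b2 := hb 1 2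
  have s01 := hs 0 1
  have s02 := hs 0 2
  have s03 := hs 0 3
  have s12 := hs 1 2
  have s13 := hs 1 3
  have s23 := hs 2 3
  have e1 : (240 + 6 * m 1 2).toNat =
    nvMult m [1,2,0,3] + nvMult m [1,2,3,0] + nvMult m [1,0,2,3] + nvMult m [1,0,3,2] +
    nvMult m [1,3,2,0] + nvMult m [1,3,0,2] + nvMult m [0,1,2,3] + nvMult m [0,1,3,2] +
    nvMult m [0,3,1,2] + nvMult m [3,1,2,0] + nvMult m [3,1,0,2] + nvMult m [3,0,1,2] := by
    zify; simp only [hm]; omega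
  have e2 : (240 - 6 * m 1 2).toNat =
    nvMult m [2,1,0,3] + nvMult m [2,1,3,0] + nvMult m [2,0,1,3] + nvMult m [2,0,3,1] +
    nvMult m [2,3,1,0] + nvMult m [2,3,0,1] + nvMult m [0,2,1,3] + nvMult m [0,2,3,1] +
    nvMult m [0,3,2,1] + nvMult m [3,2,1,0] + nvMult m [3,2,0,1] + nvMult m [3,0,2,1] := by
    zify; simp only [hm]; omega
  unfold nvM2
  rw [e1, e2]
  simp only [nvM4, nvP4, List.map_cons, List.map_nil, List.sum_cons, List.sum_nil,
    Multiset.map_add, Multiset.map_nsmul, Multiset.map_singleton, Multiset.map_zero, add_nsmul]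
  simp only [List.filter, Fin.reduceEq, or_false, or_true, or_self, decide_true,
    decide_false]
  abel

theorem nvM4_ok (m : Fin 4 → Fin 4 → ℤ) : ∀ l ∈ nvM4 m, NvOk Finset.univ l := by
  have h : ∀ l ∈ nvP4, NvOk Finset.univ l := by decide
  intro l hl
  have key : ∀ L : List (List (Fin 4)),
      l ∈ (L.map (fun l => nvMult m l • ({l} : Multiset (List (Fin 4))))).sum → l ∈ L := by
    intro L
    induction L with
    | nil => simp
    | cons a L ih =>
      rw [List.map_cons, List.sum_cons, Multiset.mem_add]
      rintro (h1 | h1)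
      · have := Multiset.mem_of_mem_nsmul h1
        rw [Multiset.mem_singleton] at this
        simp [this]
      · exact List.mem_cons_of_mem _ (ih h1)
  exact h l (key _ hl)

theorem nvM4_margin {m : Fin 4 → Fin 4 → ℤ} (hb : ∀ p q, -6 ≤ m p q ∧ m p q ≤ 6)
    (hs : ∀ p q, m p q = - m q p) (p q : Fin 4) (hpq : p ≠ q) :
    ((nvM4 m).countP (fun l => [p, q].isSublist l) : ℤ) -
      ((nvM4 m).countP (fun l => [q, p].isSublist l) : ℤ) = 12 * m p q := by
  have hm := nvMult_cast hb
  have s01 := hs 0 1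
  have s02 := hs 0 2
  have s03 := hs 0 3
  have s12 := hs 1 2
  have s13 := hs 1 3
  have s23 := hs 2 3
  have hcp : ∀ (r : List (Fin 4) → Bool) (l : List (Fin 4)),
      Multiset.countP (fun l => r l = true) {l} = if r l = true then 1 else 0 := by
    intro r l
    rw [← Multiset.cons_zero, Multiset.countP_cons]
    simp
  fin_cases p <;> fin_cases q <;> first
    | exact absurd rfl hpq
    | simp only [nvM4, nvP4, List.map_cons, List.map_nil, List.sum_cons, List.sum_nil,
        Multiset.countP_add, Multiset.countP_nsmul, hcp, List.isSublist,
        Fin.zero_eta, Fin.mk_one, Fin.reduceFinMk, if_true, if_false,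
        Fin.reduceBEq, Bool.false_eq_true, mul_one, mul_zero, add_zero, zero_add, Nat.cast_add, hm]
      linarith

section
variable {C V : Type} {c : Fin 4 ↪ C} {e : ℕ ↪ V} {F : VotingMethod C V}

theorem nvM3_ok (x y z : ℤ) : ∀ l ∈ nvM3 3 0 2 x y z, NvOk {3, 0, 2} l := by
  intro l hl
  simp only [nvM3, Multiset.mem_add] at hl
  rcases hl with ((((hl | hl) | hl) | hl) | hl) | hl <;>
  · have := Multiset.mem_of_mem_nsmul hl
    rw [Multiset.mem_singleton] at this
    subst this
    decide

theorem nvM2_ok (p q : Fin 4) (hpq : p ≠ q) (w : ℤ) : ∀ l ∈ nvM2 p q w, NvOk {p, q} l := by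
  have h : ∀ p q : Fin 4, p ≠ q → NvOk {p, q} [p, q] ∧ NvOk {p, q} [q, p] := by decide
  intro l hl
  simp only [nvM2, Multiset.mem_add] at hl
  rcases hl with hl | hl
  · have := Multiset.mem_of_mem_nsmul hl
    rw [Multiset.mem_singleton] at this
    subst this
    exact (h p q hpq).1
  · have := Multiset.mem_of_mem_nsmul hl
    rw [Multiset.mem_singleton] at this
    subst this
    exact (h p q hpq).2

theorem nv_rot (hd : F.dom = {P : Profile C V | P.cands.card ≤ 4}) (hn : F.Neutral)
    {x y z : ℤ} {r s : Fin 4} (hrs : Equiv.swap 0 2 (Equiv.swap 0 3 r) = s)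
    (h : NvW c e F {3, 0, 2} (nvM3 3 0 2 x y z) r) :
    NvW c e F {3, 0, 2} (nvM3 3 0 2 y z x) s := by
  have h2 := nvW_swap hd hn 0 2 (nvW_swap hd hn 0 3 h)
  rw [hrs] at h2
  have e1 : Finset.map (Equiv.swap (0 : Fin 4) 2).toEmbedding
      (Finset.map (Equiv.swap (0 : Fin 4) 3).toEmbedding {3, 0, 2}) = {3, 0, 2} := by decide
  have e2 : Multiset.map (List.map (Equiv.swap (0 : Fin 4) 2))
      (Multiset.map (List.map (Equiv.swap (0 : Fin 4) 3)) (nvM3 3 0 2 x y z)) =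
      nvM3 3 0 2 y z x := by
    have a0 : Equiv.swap (0 : Fin 4) 2 (Equiv.swap (0 : Fin 4) 3 0) = 3 := by decide
    have a2 : Equiv.swap (0 : Fin 4) 2 (Equiv.swap (0 : Fin 4) 3 2) = 0 := by decide
    have a3 : Equiv.swap (0 : Fin 4) 2 (Equiv.swap (0 : Fin 4) 3 3) = 2 := by decide
    simp only [nvM3, Multiset.map_add, Multiset.map_nsmul, Multiset.map_singleton,
      List.map_cons, List.map_nil, a0, a2, a3]
    abel
  rwa [e1, e2] at h2

theorem nv_swap12 (hd : F.dom = {P : Profile C V | P.cands.card ≤ 4}) (hn : F.Neutral)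
    {x y z : ℤ} (h : NvW c e F {3, 0, 2} (nvM3 3 0 2 x y z) 2) :
    NvW c e F {3, 0, 1} (nvM3 3 0 1 x y z) 1 := by
  have h2 := nvW_swap hd hn 1 2 h
  have a0 : Equiv.swap (1 : Fin 4) 2 0 = 0 := by decide
  have a2 : Equiv.swap (1 : Fin 4) 2 2 = 1 := by decide
  have a3 : Equiv.swap (1 : Fin 4) 2 3 = 3 := by decide
  have e1 : Finset.map (Equiv.swap (1 : Fin 4) 2).toEmbedding {3, 0, 2} = {3, 0, 1} := by decide
  rw [e1, a2] at h2
  simpa only [nvM3, Multiset.map_add, Multiset.map_nsmul, Multiset.map_singleton,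
      List.map_cons, List.map_nil, a0, a2, a3] using h2

theorem nv_duel (hd : F.dom = {P : Profile C V | P.cands.card ≤ 4}) (ha : F.Anonymous)
    (hn : F.Neutral) (p q : Fin 4) (hpq : p ≠ q) (w : ℤ) :
    NvW c e F {p, q} (nvM2 p q w) p ∨ NvW c e F {p, q} (nvM2 p q (-w)) p := by
  obtain ⟨r, hr, h⟩ := nvW_ex (c := c) (e := e) hd ha ⟨p, by simp⟩ (nvM2_ok p q hpq w)
  rcases (by simpa using hr : r = p ∨ r = q) with rfl | rfl
  · exact Or.inl h
  · right
    have h2 := nvW_swap hd hn p r h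
    have e1 : Finset.map (Equiv.swap p r).toEmbedding {p, r} = {p, r} := by
      clear h2 h hr
      revert p r
      decide
    rw [e1, Equiv.swap_apply_right] at h2
    have e2 : Multiset.map (List.map (Equiv.swap p r)) (nvM2 p r w) = nvM2 p r (-w) := by
      simp only [nvM2, Multiset.map_add, Multiset.map_nsmul, Multiset.map_singleton,
        List.map_cons, List.map_nil, Equiv.swap_apply_left, Equiv.swap_apply_right]
      rw [add_comm]
      congr 3 <;> ring
    rwa [e2] at h2

theorem nv_duel_iff (hd : F.dom = {P : Profile C V | P.cands.card ≤ 4}) (ha : F.Anonymous)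
    (hq : F.QuasiResolute) (p q : Fin 4) (hpq : p ≠ q) (w : ℤ) (hw : w ≠ 0)
    (hb : -6 ≤ w ∧ w ≤ 6) (h : NvW c e F {p, q} (nvM2 p q w) p) :
    ∀ z, z = p ∨ z = q → (NvW c e F {p, q} (nvM2 p q w) z ↔ z = p) := by
  intro z _
  constructor
  · intro hz
    have i1 : ∀ p q : Fin 4, p ≠ q → [p, q].isSublist [p, q] = true ∧
      [p, q].isSublist [q, p] = false := by decide
    have hcp : ∀ (r : List (Fin 4) → Bool) (l : List (Fin 4)),
        Multiset.countP (fun l => r l = true) {l} = if r l = true then 1 else 0 := by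
      intro r l
      rw [← Multiset.cons_zero, Multiset.countP_cons]
      simp
    refine nvW_uniq hd ha hq ⟨p, by simp⟩ (nvM2_ok p q hpq w)
      (fun a _ => if a = p then 12 * w else - (12 * w)) ?_ ?_ hz h
    · intro a haX b hbX hab
      simp only [Finset.mem_insert, Finset.mem_singleton] at haX hbX
      have j := i1 p q hpq
      have j' := i1 q p hpq.symm
      rcases haX with rfl | rfl <;> rcases hbX with rfl | rfl
      · exact absurd rfl hab
      · simp only [nvM2, Multiset.countP_add, Multiset.countP_nsmul, hcp, j, j', if_true]
        simp only [Bool.false_eq_true, if_false, mul_one, mul_zero, add_zero, zero_add]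
        omega
      · simp only [nvM2, Multiset.countP_add, Multiset.countP_nsmul, hcp, j, j', hpq.symm, if_false]
        simp only [Bool.false_eq_true, if_true, if_false, mul_one, mul_zero, add_zero, zero_add]
        omega
      · exact absurd rfl hab
    · intro a haX b hbX r hrX s hsX hab hrs hne
      simp only [Finset.mem_insert, Finset.mem_singleton] at haX hbX hrX hsX
      have hq' := hpq.symm
      rcases haX with rfl | rfl <;> rcases hbX with rfl | rfl <;> rcases hrX with rfl | rfl <;>
        rcases hsX with rfl | rfl <;> simp_all <;> omega
  · rintro rfl
    exact h

def nvLab : Fin 4 → Fin 4 → Fin 6 := ![![0,0,4,3],![0,0,1,5],![4,1,0,2],![3,5,2,0]]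
def nvSg : Fin 4 → Fin 4 → ℤ := ![![0,1,1,-1],![-1,0,1,1],![-1,-1,0,1],![1,-1,-1,0]]

theorem nv_core (hd : F.dom = {P : Profile C V | P.cands.card ≤ 4}) (ha : F.Anonymous)
    (hn : F.Neutral) (hg : F.BinaryGamma) (hq : F.QuasiResolute)
    (W : Fin 6 → ℤ) (L : Fin 6 → Fin 6) (hL : Function.Injective L)
    (hW : ∀ i, (W i).natAbs = (L i : ℕ) + 1)
    (h01 : NvW c e F {0, 1} (nvM2 0 1 (W 0)) 0) (h12 : NvW c e F {1, 2} (nvM2 1 2 (W 1)) 1)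
    (hA : NvW c e F {3, 0, 2} (nvM3 3 0 2 (W 4) (W 2) (W 3)) 3)
    (hB : NvW c e F {3, 0, 2} (nvM3 3 0 2 (W 5) (W 3) (W 0)) 3) : False := by
  have hW0 : ∀ i, W i ≠ 0 := by
    intro i h
    have := hW i
    rw [h] at this
    simp at this
  have hWb : ∀ i, -6 ≤ W i ∧ W i ≤ 6 := by
    intro i
    have := hW i
    have := (L i).isLt
    omega
  obtain ⟨m, hm⟩ : ∃ m : Fin 4 → Fin 4 → ℤ, ∀ p q, m p q = nvSg p q * W (nvLab p q) :=
    ⟨_, fun _ _ => rfl⟩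
  have hsg : ∀ p q, p ≠ q → nvSg p q = 1 ∨ nvSg p q = -1 := by decide
  have hsg' : ∀ p q, nvSg p q = 1 ∨ nvSg p q = -1 ∨ nvSg p q = 0 := by decide
  have hsgs : ∀ p q, nvSg p q = - nvSg q p := by decide
  have hls : ∀ p q, nvLab p q = nvLab q p := by decide
  have hli : ∀ p q r s, p ≠ q → r ≠ s → nvLab p q = nvLab r s →
    (p = r ∧ q = s) ∨ (p = s ∧ q = r) := by decide
  have hb : ∀ p q, -6 ≤ m p q ∧ m p q ≤ 6 := by
    intro p q
    have := hWb (nvLab p q)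
    rw [hm]
    rcases hsg' p q with h | h | h <;> rw [h] <;> omega
  have hs : ∀ p q, m p q = - m q p := by
    intro p q
    rw [hm, hm, hls p q, hsgs p q]
    ring
  have habs : ∀ p q, p ≠ q → (m p q).natAbs = (L (nvLab p q) : ℕ) + 1 := by
    intro p q hpq
    rw [← hW, hm, Int.natAbs_mul]
    rcases hsg p q hpq with h | h <;> rw [h] <;> simp
  have m01 : m 0 1 = W 0 := by rw [hm]; simp [nvSg, nvLab]
  have m12 : m 1 2 = W 1 := by rw [hm]; simp [nvSg, nvLab]
  have m23 : m 2 3 = W 2 := by rw [hm]; simp [nvSg, nvLab]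
  have m30 : m 3 0 = W 3 := by rw [hm]; simp [nvSg, nvLab]
  have m02 : m 0 2 = W 4 := by rw [hm]; simp [nvSg, nvLab]
  have m13 : m 1 3 = W 5 := by rw [hm]; simp [nvSg, nvLab]
  have hA' : NvW c e F {3, 0, 2} (nvM3 3 0 2 (W 3) (W 4) (W 2)) 0 :=
    nv_rot hd hn (r := 2) (by decide) (nv_rot hd hn (r := 3) (by decide) hA)
  have hB' : NvW c e F {3, 0, 1} (nvM3 3 0 1 (W 3) (W 0) (W 5)) 1 :=
    nv_swap12 hd hn (nv_rot hd hn (r := 3) (by decide) hB)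
  have win0 : NvW c e F Finset.univ (nvM4 m) 0 := by
    refine nvW_gamma hd ha hg (nvM4_ok m) (x := 0) (y := 1) (Finset.mem_univ _)
      (Finset.mem_univ _) (by decide) (f := fun z => decide (z ≠ 1))
      (g := fun z => decide (z = 0 ∨ z = 1)) (by decide) (by decide) ?_ ?_
    · rw [nvM4_minus1 hb hs _ rfl, m30, m02, m23]
      have e1 : (Finset.univ : Finset (Fin 4)).erase 1 = {3, 0, 2} := by decide
      rw [e1]
      exact hA'
    · rw [nvM4_pair01 hb hs _ rfl, m01]
      exact nv_duel_iff hd ha hq 0 1 (by decide) _ (hW0 0) (hWb 0) h01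
  have win1 : NvW c e F Finset.univ (nvM4 m) 1 := by
    refine nvW_gamma hd ha hg (nvM4_ok m) (x := 1) (y := 2) (Finset.mem_univ _)
      (Finset.mem_univ _) (by decide) (f := fun z => decide (z ≠ 2))
      (g := fun z => decide (z = 1 ∨ z = 2)) (by decide) (by decide) ?_ ?_
    · rw [nvM4_minus2 hb hs _ rfl, m30, m01, m13]
      have e1 : (Finset.univ : Finset (Fin 4)).erase 2 = {3, 0, 1} := by decide
      rw [e1]
      exact hB'
    · rw [nvM4_pair12 hb hs _ rfl, m12]
      exact nv_duel_iff hd ha hq 1 2 (by decide) _ (hW0 1) (hWb 1) h12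
  have := nvW_uniq hd ha hq ⟨0, Finset.mem_univ _⟩ (nvM4_ok m) (fun p q => 12 * m p q)
    (fun p _ q _ hpq => nvM4_margin hb hs p q hpq) (by
      intro p _ q _ r _ s _ hpq hrs hne heq
      have heq' : m p q = m r s := by
        have : 12 * m p q = 12 * m r s := heq
        omega
      have h1 := habs p q hpq
      have h2 := habs r s hrs
      have h3 : L (nvLab p q) = L (nvLab r s) := by
        apply Fin.ext
        rw [heq'] at h1
        omega
      rcases hli p q r s hpq hrs (hL h3) with ⟨rfl, rfl⟩ | ⟨rfl, rfl⟩
      · exact hne rfl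
      · have := hs p q
        omega) win0 win1
  exact absurd this (by decide)

end

theorem nv_comb (t : Fin 6 → Fin 6 → Fin 6 → Prop)
    (ex : ∀ a b d : Fin 6, [a, b, d].Nodup → t a b d ∨ t b d a ∨ t d a b)
    (star : ∀ x y k u v : Fin 6, [x, y, k, u, v].Nodup → t x y k → t v k u → False) :
    False := by
  rcases ex 0 1 2 (by decide) with h012 | h120 | h201
  · rcases ex 1 3 4 (by decide) with h134 | h341 | h413
    · rcases ex 2 4 5 (by decide) with h245 | h452 | h524
      · exact star 1 3 4 5 2 (by decide) h134 h245
      · rcases ex 0 3 2 (by decide) with h032 | h320 | h203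
        · rcases ex 1 3 5 (by decide) with h135 | h351 | h513
          · exact star 1 3 5 2 4 (by decide) h135 h452
          · exact star 3 5 1 2 0 (by decide) h351 h012
          · exact star 5 1 3 2 0 (by decide) h513 h032
        · exact star 4 5 2 0 3 (by decide) h452 h320
        · exact star 2 0 3 4 1 (by decide) h203 h134
      · exact star 0 1 2 4 5 (by decide) h012 h524
    · exact star 3 4 1 2 0 (by decide) h341 h012
    · rcases ex 2 3 5 (by decide) with h235 | h352 | h523
      · exact star 4 1 3 5 2 (by decide) h413 h235
      · rcases ex 0 1 5 (by decide) with h015 | h150 | h501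
        · exact star 0 1 5 2 3 (by decide) h015 h352
        · rcases ex 0 2 3 (by decide) with h023 | h230 | h302
          · rcases ex 2 4 5 (by decide) with h245 | h452 | h524
            · exact star 2 4 5 0 1 (by decide) h245 h150
            · exact star 4 5 2 3 0 (by decide) h452 h023
            · exact star 0 1 2 4 5 (by decide) h012 h524
          · exact star 4 1 3 0 2 (by decide) h413 h230
          · exact star 1 5 0 2 3 (by decide) h150 h302
        · exact star 5 0 1 3 4 (by decide) h501 h413
      · exact star 0 1 2 3 5 (by decide) h012 h523
  · rcases ex 0 3 4 (by decide) with h034 | h340 | h403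
    · rcases ex 2 3 5 (by decide) with h235 | h352 | h523
      · rcases ex 0 4 3 (by decide) with h043 | h430 | h304
        · exact star 0 4 3 5 2 (by decide) h043 h235
        · rcases ex 0 1 5 (by decide) with h015 | h150 | h501
          · rcases ex 0 4 5 (by decide) with h045 | h450 | h504
            · rcases ex 1 3 4 (by decide) with h134 | h341 | h413
              · exact star 1 3 4 5 0 (by decide) h134 h045
              · exact star 3 4 1 5 0 (by decide) h341 h015
              · exact star 4 1 3 5 2 (by decide) h413 h235
            · exact star 2 3 5 0 4 (by decide) h235 h450
            · exact star 1 2 0 4 5 (by decide) h120 h504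
          · exact star 2 3 5 0 1 (by decide) h235 h150
          · exact star 4 3 0 1 5 (by decide) h430 h501
        · exact star 1 2 0 4 3 (by decide) h120 h304
      · exact star 3 5 2 0 1 (by decide) h352 h120
      · exact star 5 2 3 4 0 (by decide) h523 h034
    · rcases ex 2 4 5 (by decide) with h245 | h452 | h524
      · rcases ex 0 1 5 (by decide) with h015 | h150 | h501
        · rcases ex 0 3 5 (by decide) with h035 | h350 | h503
          · rcases ex 1 3 4 (by decide) with h134 | h341 | h413
            · exact star 1 3 4 5 2 (by decide) h134 h245
            · exact star 3 4 1 5 0 (by decide) h341 h015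
            · exact star 4 1 3 5 0 (by decide) h413 h035
          · exact star 2 4 5 0 3 (by decide) h245 h350
          · exact star 1 2 0 3 5 (by decide) h120 h503
        · exact star 2 4 5 0 1 (by decide) h245 h150
        · exact star 3 4 0 1 5 (by decide) h340 h501
      · exact star 4 5 2 0 1 (by decide) h452 h120
      · exact star 5 2 4 0 3 (by decide) h524 h340
    · exact star 1 2 0 3 4 (by decide) h120 h403
  · rcases ex 0 3 4 (by decide) with h034 | h340 | h403
    · rcases ex 1 4 5 (by decide) with h145 | h451 | h514
      · exact star 0 3 4 5 1 (by decide) h034 h145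
      · rcases ex 0 3 5 (by decide) with h035 | h350 | h503
        · exact star 0 3 5 1 4 (by decide) h035 h451
        · exact star 3 5 0 1 2 (by decide) h350 h201
        · rcases ex 1 2 3 (by decide) with h123 | h231 | h312
          · exact star 1 2 3 4 0 (by decide) h123 h034
          · exact star 5 0 3 1 2 (by decide) h503 h231
          · exact star 4 5 1 2 3 (by decide) h451 h312
      · exact star 2 0 1 4 5 (by decide) h201 h514
    · exact star 3 4 0 1 2 (by decide) h340 h201
    · rcases ex 1 3 5 (by decide) with h135 | h351 | h513
      · exact star 4 0 3 5 1 (by decide) h403 h135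
      · rcases ex 0 2 5 (by decide) with h025 | h250 | h502
        · exact star 0 2 5 1 3 (by decide) h025 h351
        · exact star 2 5 0 3 4 (by decide) h250 h403
        · rcases ex 0 1 4 (by decide) with h014 | h140 | h401
          · exact star 3 5 1 4 0 (by decide) h351 h014
          · exact star 1 4 0 2 5 (by decide) h140 h502
          · rcases ex 1 2 3 (by decide) with h123 | h231 | h312
            · exact star 5 0 2 3 1 (by decide) h502 h123
            · exact star 4 0 3 1 2 (by decide) h403 h231
            · exact star 4 0 1 2 3 (by decide) h401 h312
      · exact star 2 0 1 3 5 (by decide) h201 h513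

theorem nv_main {C V : Type} (c : Fin 4 ↪ C) (e : ℕ ↪ V) {F : VotingMethod C V}
    (hd : F.dom = {P : Profile C V | P.cands.card ≤ 4}) (ha : F.Anonymous)
    (hn : F.Neutral) (hg : F.BinaryGamma) (hq : F.QuasiResolute) : False := by
  have hw : ∀ i : Fin 6, ∃ w : ℤ, w.natAbs = (i : ℕ) + 1 ∧
      NvW c e F {0, 1} (nvM2 0 1 w) 0 := by
    intro i
    rcases nv_duel (c := c) (e := e) hd ha hn 0 1 (by decide) ((i : ℕ) + 1 : ℤ) with h | h
    · exact ⟨_, by omega, h⟩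
    · exact ⟨_, by omega, h⟩
  choose w hw1 hw2 using hw
  refine nv_comb (fun i j k => NvW c e F {3, 0, 2} (nvM3 3 0 2 (w i) (w j) (w k)) 3) ?_ ?_
  · intro i j k _
    obtain ⟨r, hr, h⟩ := nvW_ex (c := c) (e := e) hd ha ⟨3, by simp⟩
      (nvM3_ok (w i) (w j) (w k))
    rcases (by simpa using hr : r = 3 ∨ r = 0 ∨ r = 2) with rfl | rfl | rfl
    · exact Or.inl h
    · exact Or.inr (Or.inl (nv_rot hd hn (by decide) h))
    · exact Or.inr (Or.inr (nv_rot hd hn (r := 0) (by decide) (nv_rot hd hn (by decide) h)))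
  · intro x y k u v hnd hA hB
    obtain ⟨z, hz⟩ : ∃ z : Fin 6, z ∉ ([x, y, k, u, v].toFinset) := by
      by_contra hcon
      push Not at hcon
      have h1 : (Finset.univ : Finset (Fin 6)) ⊆ [x, y, k, u, v].toFinset := fun z _ => hcon z
      have h2 := (Finset.card_le_card h1).trans (List.toFinset_card_le _)
      simp at h2
    have hz' : ∃ wz : ℤ, wz.natAbs = (z : ℕ) + 1 ∧ NvW c e F {1, 2} (nvM2 1 2 wz) 1 := by
      rcases nv_duel (c := c) (e := e) hd ha hn 1 2 (by decide) ((z : ℕ) + 1 : ℤ) with h | h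
      · exact ⟨_, by omega, h⟩
      · exact ⟨_, by omega, h⟩
    obtain ⟨wz, hz1, hz2⟩ := hz'
    refine nv_core hd ha hn hg hq ![w u, wz, w y, w k, w x, w v] ![u, z, y, k, x, v] ?_ ?_
      (hw2 u) hz2 hA hB
    · simp only [List.mem_toFinset, List.mem_cons, List.not_mem_nil, or_false, not_or] at hz
      obtain ⟨z1, z2, z3, z4, z5⟩ := hz
      simp only [List.nodup_cons, List.mem_cons, List.not_mem_nil, or_false, not_or] at hnd
      obtain ⟨⟨a1, a2, a3, a4⟩, ⟨b1, b2, b3⟩, ⟨c1, c2⟩, d1, _⟩ := hnd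
      have hl : [u, z, y, k, x, v].Nodup := by
        simp only [List.nodup_cons, List.mem_cons, List.not_mem_nil, or_false, not_or,
          not_false_eq_true, List.nodup_nil, and_true]
        refine ⟨⟨?_, ?_, ?_, ?_, ?_⟩, ⟨?_, ?_, ?_, ?_⟩, ⟨?_, ?_, ?_⟩, ⟨?_, ?_⟩, ?_⟩ <;>
          first | assumption | (apply Ne.symm; assumption)
      have := List.nodup_iff_injective_get.mp hl
      intro i j hij
      apply this
      fin_cases i <;> fin_cases j <;> exact hij
    · intro i
      fin_cases i
      · exact hw1 u
      · exact hz1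
      · exact hw1 y
      · exact hw1 k
      · exact hw1 x
      · exact hw1 v

/-- There is no voting method whose domain is the set of all profiles
with at most 4 candidates that satisfies anonymity, neutrality, binary γ, and
quasi-resoluteness. -/
theorem no_voting_method_four_candidates (C V : Type) [Infinite C] [Infinite V] :
    ¬ ∃ F : VotingMethod C V,
      F.dom = {P : Profile C V | P.cands.card ≤ 4} ∧
      F.Anonymous ∧ F.Neutral ∧ F.BinaryGamma ∧ F.QuasiResolute := by
  rintro ⟨F, hd, ha, hn, hg, hq⟩
  exact nv_main (Fin.valEmbedding.trans (Infinite.natEmbedding C)) (Infinite.natEmbedding V)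
    hd ha hn hg hq
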